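/- The number of permutations of {1,...,n} with exactly two occurrences of the pattern [1,2,3] equals (59n² + 117n + 100)/(2n(2n−1)(n+5)) · C(2n, n−4), equivalently (2n−2)!/((n−4)!(n+5)!) · (59n² + 117n + 100). -/

import Mathlib

open Finset

/-- Number of occurrences of the increasing pattern [1,2,3] in `π`. -/
def N3 {n : ℕ} (π : Equiv.Perm (Fin n)) : ℕ :=
  (Finset.univ.filter fun t : Fin n × Fin n × Fin n =>
    t.1 < t.2.1 ∧ t.2.1 < t.2.2 ∧ π t.1 < π t.2.1 ∧ π t.2.1 < π t.2.2).card

/-! ### Binomial coefficients with integer lower index -/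

def PB (a : ℕ) (b : ℤ) : ℤ := if b < 0 then 0 else (a.choose b.toNat : ℤ)

lemma PB_neg (a : ℕ) (b : ℤ) (h : b < 0) : PB a b = 0 := by simp [PB, h]

lemma PB_nat (a b : ℕ) : PB a (b : ℤ) = (a.choose b : ℤ) := by simp [PB]

lemma PB_succ (a : ℕ) (b : ℤ) : PB (a + 1) b = PB a b + PB a (b - 1) := by
  rcases lt_trichotomy b 0 with h | h | h
  · rw [PB_neg _ _ h, PB_neg _ _ h, PB_neg _ _ (by omega)]; rfl
  · subst h; simp [PB]
  · obtain ⟨c, rfl⟩ : ∃ c : ℕ, b = (c : ℤ) + 1 := ⟨(b - 1).toNat, by omega⟩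
    have e : ((c : ℤ) + 1) = ((c + 1 : ℕ) : ℤ) := by push_cast; rfl
    rw [show (c : ℤ) + 1 - 1 = (c : ℤ) by ring, e, PB_nat, PB_nat, PB_nat, Nat.choose_succ_succ]
    push_cast; ring

lemma PB_symm (a : ℕ) (b : ℤ) : PB a b = PB a (a - b) := by
  rcases lt_or_ge b 0 with h | h
  · rw [PB_neg _ _ h]
    obtain ⟨c, hc⟩ : ∃ c : ℕ, (a : ℤ) - b = c := ⟨(a - b).toNat, by omega⟩
    rw [hc, PB_nat, Nat.choose_eq_zero_of_lt (by omega)]; rfl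
  · obtain ⟨c, rfl⟩ : ∃ c : ℕ, b = (c : ℤ) := ⟨b.toNat, by omega⟩
    rcases le_or_gt c a with h' | h'
    · rw [show (a : ℤ) - c = ((a - c : ℕ) : ℤ) by omega, PB_nat, PB_nat, Nat.choose_symm h']
    · rw [PB_neg _ (a - c) (by omega), PB_nat, Nat.choose_eq_zero_of_lt h']; rfl

lemma PB_two (a : ℕ) (b : ℤ) : PB (a + 2) b = PB a b + 2 * PB a (b - 1) + PB a (b - 2) := by
  rw [PB_succ (a + 1), PB_succ a, PB_succ a, show b - 1 - 1 = b - 2 by ring]; ring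

lemma PB_three (a : ℕ) (b : ℤ) :
    PB (a + 3) b = PB a b + 3 * PB a (b - 1) + 3 * PB a (b - 2) + PB a (b - 3) := by
  rw [PB_succ (a + 2), PB_two a, PB_two a, show b - 1 - 1 = b - 2 by ring,
    show b - 1 - 2 = b - 3 by ring]; ring

lemma PB_four (a : ℕ) (b : ℤ) :
    PB (a + 4) b = PB a b + 4 * PB a (b - 1) + 6 * PB a (b - 2) + 4 * PB a (b - 3)
      + PB a (b - 4) := by
  rw [PB_succ (a + 3), PB_three a, PB_three a, show b - 1 - 1 = b - 2 by ring,
    show b - 1 - 2 = b - 3 by ring, show b - 1 - 3 = b - 4 by ring]; ring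

/-! ### The closed forms -/

def cA (n K : ℕ) : ℤ := PB (2 * n + K + 1) n - PB (2 * n + K + 1) (n - 1)
def cE (n K : ℕ) : ℤ := PB (2 * n + K) (n - 1) - PB (2 * n + K) (n - 2)
def cH (n K : ℕ) : ℤ := PB (2 * n + K - 1) (n - 2) - PB (2 * n + K - 1) (n - 3)
def cb (n K : ℕ) : ℤ := PB (2 * n + K) (n - 1) - PB (2 * n + K) (n - 4) - cE n 0
def cF (n K : ℕ) : ℤ := PB (2 * n + K - 1) (n - 2) - PB (2 * n + K - 1) (n - 5)
def cd (n K : ℕ) : ℤ :=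
  2 * PB (2 * n + K - 1) (n - 1) + 3 * PB (2 * n + K - 1) (n - 2) + PB (2 * n + K - 1) (n - 3)
  + PB (2 * n + K - 1) (n - 4) - 3 * PB (2 * n + K - 1) (n - 5) - 3 * PB (2 * n + K - 1) (n - 6)
  - PB (2 * n + K - 1) (n - 7)
  + (- cH (n + 1) 0 + 2 * cH n 0 - cF n 0 - cE n 1) - (K + 2) * cH n 0

lemma cA_zero (K : ℕ) : cA 0 K = 1 := by simp [cA, PB]
lemma cE_zero (K : ℕ) : cE 0 K = 0 := by simp [cE, PB]
lemma cH_zero (K : ℕ) : cH 0 K = 0 := by simp [cH, PB]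
lemma cb_zero (K : ℕ) : cb 0 K = 0 := by simp [cb, PB, cE_zero]
lemma cF_zero (K : ℕ) : cF 0 K = 0 := by simp [cF, PB]
lemma cd_zero (K : ℕ) : cd 0 K = 0 := by simp [cd, PB, cE_zero, cH_zero, cF_zero, cH]

lemma cA_diff (n K : ℕ) : cA (n + 1) (K + 1) = cA (n + 1) K + cA n (K + 2) := by
  simp only [cA]
  rw [show 2 * (n + 1) + (K + 1) + 1 = (2 * n + K + 3) + 1 by ring,
    show 2 * (n + 1) + K + 1 = (2 * n + K + 3) by ring,
    show 2 * n + (K + 2) + 1 = (2 * n + K + 3) by ring]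
  simp only [PB_succ (2 * n + K + 3)]
  push_cast; ring_nf

lemma cA_base (n : ℕ) : cA (n + 1) 0 = cA n 0 + cA n 1 := by
  have h := PB_symm (2 * n + 1) n
  simp only [cA]
  rw [show 2 * (n + 1) + 0 + 1 = (2 * n + 1) + 2 by ring,
    show 2 * n + 0 + 1 = (2 * n + 1) by ring,
    show 2 * n + 1 + 1 = (2 * n + 1) + 1 by ring]
  simp only [PB_succ (2 * n + 1), PB_two (2 * n + 1)]
  push_cast at h ⊢; ring_nf at h ⊢; linarith

lemma cA_rec (n K : ℕ) : cA (n + 1) K = ∑ j ∈ range (K + 2), cA n j := by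
  induction K with
  | zero => simp [sum_range_succ, cA_base]
  | succ K ih => rw [sum_range_succ, ← ih, cA_diff]

lemma cE_rec (n K : ℕ) : cE (n + 1) K = cE n (K + 1) + cA n K := by
  simp only [cA, cE]
  rw [show 2 * (n + 1) + K = (2 * n + K + 1) + 1 by ring,
    show 2 * n + (K + 1) = (2 * n + K + 1) by ring]
  simp only [PB_succ (2 * n + K + 1)]
  push_cast; ring_nf

lemma cH_rec (n K : ℕ) : cH (n + 1) K = cH n (K + 1) + cE n K := by
  simp only [cH, cE]
  rw [show 2 * (n + 1) + K - 1 = (2 * n + K) + 1 by omega,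
    show 2 * n + (K + 1) - 1 = (2 * n + K) by omega]
  simp only [PB_succ (2 * n + K)]
  push_cast; ring_nf

lemma cF_rec (n K : ℕ) : cF (n + 1) K = cF n (K + 1) + cE n 0 + cb n K := by
  simp only [cF, cb]
  rw [show 2 * (n + 1) + K - 1 = (2 * n + K) + 1 by omega,
    show 2 * n + (K + 1) - 1 = (2 * n + K) by omega]
  simp only [PB_succ (2 * n + K)]
  push_cast; ring_nf

lemma cb_diff (n K : ℕ) : cb (n + 1) (K + 1) = cb (n + 1) K + cb n (K + 2) + cE n 0 := by
  simp only [cb]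
  rw [show 2 * (n + 1) + (K + 1) = (2 * n + K + 2) + 1 by ring,
    show 2 * (n + 1) + K = (2 * n + K + 2) by ring,
    show 2 * n + (K + 2) = (2 * n + K + 2) by ring]
  simp only [PB_succ (2 * n + K + 2)]
  push_cast; ring_nf

lemma cb_base (n : ℕ) : cb (n + 1) 0 = cb n 0 + cb n 1 + cE n 0 := by
  have h := PB_symm (2 * n) n
  have h1 := PB_symm (2 * n) (n - 1)
  have h2 := PB_symm (2 * n) (n - 2)
  simp only [cb, cE]
  rw [show 2 * (n + 1) + 0 = (2 * n) + 2 by ring,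
    show 2 * n + 0 = (2 * n) by ring]
  simp only [PB_succ (2 * n), PB_two (2 * n)]
  push_cast at h h1 h2 ⊢; ring_nf at h h1 h2 ⊢

lemma cb_rec (n K : ℕ) : cb (n + 1) K = ∑ j ∈ range (K + 2), cb n j + (K + 1) * cE n 0 := by
  induction K with
  | zero => simp [sum_range_succ, cb_base]
  | succ K ih => rw [sum_range_succ, cb_diff, ih]; push_cast; ring

lemma cd_diff (n K : ℕ) : cd (n + 1) (K + 1) =
    cd (n + 1) K + cd n (K + 2) + cF n 0 + (K + 2) * cH n 0 + cE n 1 := by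
  simp only [cd]
  rw [show 2 * (n + 1) + (K + 1) - 1 = (2 * n + K + 1) + 1 by omega,
    show 2 * (n + 1) + K - 1 = (2 * n + K + 1) by omega,
    show 2 * n + (K + 2) - 1 = (2 * n + K + 1) by omega]
  simp only [PB_succ (2 * n + K + 1)]
  push_cast; ring_nf

lemma cd_base (n : ℕ) : cd (n + 1) 0 = cd n 0 + cd n 1 + cF n 0 + cH n 0 := by
  rcases n with _ | n
  · simp only [cd, cH, cF, cE, PB]; decide
  have h := fun j : ℤ => PB_symm (2 * n + 1) (n + j)
  have h0 := h 0
  have h1 := h (-1)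
  have h2 := h (-2)
  have h3 := h (-3)
  have h4 := h (-4)
  have h5 := h (-5)
  have h6 := h (-6)
  clear h
  simp only [cd, cH, cE, cF]
  rw [show 2 * (n + 1 + 1) + 0 - 1 = (2 * n + 1) + 2 by omega,
    show 2 * (n + 1 + 1 + 1) + 0 - 1 = (2 * n + 1) + 4 by omega,
    show 2 * (n + 1 + 1) + 1 = (2 * n + 1) + 4 by omega,
    show 2 * (n + 1) + 1 - 1 = (2 * n + 1) + 1 by omega,
    show 2 * (n + 1) + 1 = (2 * n + 1) + 2 by omega,
    show 2 * (n + 1) + 0 - 1 = (2 * n + 1) by omega]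
  simp only [PB_succ (2 * n + 1), PB_two (2 * n + 1), PB_three (2 * n + 1), PB_four (2 * n + 1)]
  push_cast at h0 h1 h2 h3 h4 h5 h6 ⊢
  ring_nf at h0 h1 h2 h3 h4 h5 h6 ⊢

lemma cd_rec (n K : ℕ) : cd (n + 1) K = ∑ j ∈ range (K + 2), cd n j + (K + 1) * cF n 0
    + ((K + 2).choose 2 : ℕ) * cH n 0 + K * cE n 1 := by
  induction K with
  | zero => simp [sum_range_succ, cd_base]
  | succ K ih =>
    rw [sum_range_succ, cd_diff, ih, show K + 1 + 2 = (K + 2) + 1 by ring,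
      Nat.choose_succ_succ (K + 2) 1]
    simp; ring

/-! ### Weighted extension counts -/

def upd (f : ℕ → ℕ) (p i : ℕ) : ℕ := if i ≤ p then f i else f (i - 1) + p

def WW : ℕ → (ℕ → ℕ) → ℕ → ℕ → ℤ
  | 0, _, _, r => if r = 0 then 1 else 0
  | n + 1, f, M, r =>
    ∑ p ∈ range (M + 1), if f p ≤ r then WW n (upd f p) (M + 1) (r - f p) else 0

structure St (f : ℕ → ℕ) (M K l c : ℕ) : Prop where
  le : K + 2 + l + c ≤ M + 1
  z : ∀ i, i < K + 2 → f i = 0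
  o : ∀ i, K + 2 ≤ i → i < K + 2 + l → f i = 1
  t : ∀ i, K + 2 + l ≤ i → i < K + 2 + l + c → f i = 2
  g : ∀ i, K + 2 + l + c ≤ i → i ≤ M → 3 ≤ f i

section
variable {f : ℕ → ℕ} {M K l c : ℕ}

lemma St.lo (h : St f M K l c) (i : ℕ) (hi : K + 2 ≤ i) (hM : i ≤ M) : 1 ≤ f i := by
  by_cases h1 : i < K + 2 + l
  · rw [h.o i hi h1]
  by_cases h2 : i < K + 2 + l + c
  · rw [h.t i (by omega) h2]; omega
  · have := h.g i (by omega) hM; omega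

lemma St.lo2 (h : St f M K l c) (i : ℕ) (hi : K + 2 + l ≤ i) (hM : i ≤ M) : 2 ≤ f i := by
  by_cases h2 : i < K + 2 + l + c
  · rw [h.t i (by omega) h2]
  · have := h.g i (by omega) hM; omega

lemma St.upd0 (h : St f M K l c) : St (upd f 0) (M + 1) (K + 1) l c := by
  have hle := h.le
  refine ⟨by omega, ?_, ?_, ?_, ?_⟩ <;> intro i <;> intros <;> simp only [upd] <;> split_ifs
  · exact h.z _ (by omega)
  · rw [h.z _ (by omega)]
  · omega
  · rw [h.o _ (by omega) (by omega)]
  · omega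
  · rw [h.t _ (by omega) (by omega)]
  · omega
  · have := h.g (i - 1) (by omega) (by omega); omega

lemma St.upd1 (h : St f M K l c) : St (upd f 1) (M + 1) 0 (K + 1) l := by
  have hle := h.le
  refine ⟨by omega, ?_, ?_, ?_, ?_⟩ <;> intro i <;> intros <;> simp only [upd] <;> split_ifs
  · exact h.z _ (by omega)
  · omega
  · omega
  · rw [h.z _ (by omega)]
  · omega
  · rw [h.o _ (by omega) (by omega)]
  · omega
  · have := h.lo2 (i - 1) (by omega) (by omega); omega

lemma St.upd2 (h : St f M K l c) (hK : 0 < K) : St (upd f 2) (M + 1) 1 0 K := by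
  have hle := h.le
  refine ⟨by omega, ?_, ?_, ?_, ?_⟩ <;> intro i <;> intros <;> simp only [upd] <;> split_ifs
  · exact h.z _ (by omega)
  · omega
  · omega
  · omega
  · omega
  · rw [h.z _ (by omega)]
  · omega
  · have := h.lo (i - 1) (by omega) (by omega); omega

lemma St.upd3 (h : St f M K l c) (j : ℕ) (h0 : 0 < j) (hj : j < K) :
    St (upd f (j + 2)) (M + 1) (j + 1) 0 0 := by
  have hle := h.le
  refine ⟨by omega, ?_, ?_, ?_, ?_⟩ <;> intro i <;> intros <;> simp only [upd] <;> split_ifs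
  · exact h.z _ (by omega)
  all_goals omega

lemma St.updj (h : St f M K l c) (j : ℕ) (hj : j < K) :
    St (upd f (j + 2)) (M + 1) (j + 1) 0 (if j = 0 then K else 0) := by
  split_ifs with h0
  · subst h0; exact h.upd2 hj
  · exact h.upd3 j (by omega) hj

lemma St.upd4 (h : St f M K l c) (j : ℕ) (hj : j < l) :
    St (upd f (K + 2 + j)) (M + 1) K (j + 1) 0 := by
  have hle := h.le
  refine ⟨by omega, ?_, ?_, ?_, ?_⟩ <;> intro i <;> intros <;> simp only [upd] <;> split_ifs
  · exact h.z _ (by omega)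
  · omega
  · exact h.o _ (by omega) (by omega)
  · omega
  · omega
  · omega
  · omega
  · have := h.lo (i - 1) (by omega) (by omega); omega

lemma St.upd5 (h : St f M K l c) (j : ℕ) (hj : j < c) :
    St (upd f (K + 2 + l + j)) (M + 1) K l (j + 1) := by
  have hle := h.le
  refine ⟨by omega, ?_, ?_, ?_, ?_⟩ <;> intro i <;> intros <;> simp only [upd] <;> split_ifs
  · exact h.z _ (by omega)
  · omega
  · exact h.o _ (by omega) (by omega)
  · omega
  · exact h.t _ (by omega) (by omega)
  · omega
  · omega
  · have := h.lo (i - 1) (by omega) (by omega); omega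

/-- Splitting the defining sum of `WW` according to the value of `f`. -/
lemma WW_split (h : St f M K l c) (n r : ℕ) (hr : r ≤ 2) :
    WW (n + 1) f M r = WW n (upd f 0) (M + 1) r + WW n (upd f 1) (M + 1) r
      + ∑ j ∈ range K, WW n (upd f (j + 2)) (M + 1) r
      + (∑ j ∈ range l, if 1 ≤ r then WW n (upd f (K + 2 + j)) (M + 1) (r - 1) else 0)
      + (∑ j ∈ range c, if 2 ≤ r then WW n (upd f (K + 2 + l + j)) (M + 1) (r - 2) else 0) := by
  have hle := h.le
  obtain ⟨e, he⟩ : ∃ e, M + 1 = K + 2 + l + c + e := ⟨M + 1 - (K + 2 + l + c), by omega⟩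
  rw [WW, he, sum_range_add, sum_range_add, sum_range_add]
  have h4 : ∑ x ∈ range e, (if f (K + 2 + l + c + x) ≤ r then
      WW n (upd f (K + 2 + l + c + x)) (K + 2 + l + c + e) (r - f (K + 2 + l + c + x)) else 0)
      = 0 := by
    apply sum_eq_zero
    intro x hx
    have := h.g (K + 2 + l + c + x) (by omega) (by have := mem_range.1 hx; omega)
    rw [if_neg (by omega)]
  rw [h4, add_zero]
  congr 1
  · congr 1
    · rw [sum_range_succ', sum_range_succ']
      simp only [h.z 0 (by omega), h.z (0 + 1) (by omega)]
      have : ∀ j ∈ range K, (if f (j + 1 + 1) ≤ r then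
        WW n (upd f (j + 1 + 1)) (K + 2 + l + c + e) (r - f (j + 1 + 1)) else 0)
        = WW n (upd f (j + 2)) (K + 2 + l + c + e) r := by
        intro j hj
        have := mem_range.1 hj
        rw [h.z (j + 1 + 1) (by omega)]; simp
      rw [sum_congr rfl this]
      simp; ring
    · apply sum_congr rfl
      intro j hj
      have := mem_range.1 hj
      rw [h.o _ (by omega) (by omega)]
  · apply sum_congr rfl
    intro j hj
    have := mem_range.1 hj
    rw [h.t _ (by omega) (by omega)]

end

lemma WW_zero (n : ℕ) : ∀ {f : ℕ → ℕ} {M K l c : ℕ}, St f M K l c → WW n f M 0 = cA n K := by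
  induction n with
  | zero => intros; simp [WW, cA_zero]
  | succ n ih =>
    intro f M K l c h
    rw [WW_split h n 0 (by omega), ih h.upd0, ih h.upd1,
      sum_congr rfl (fun j hj => ih (h.updj j (mem_range.1 hj))), cA_rec,
      sum_range_succ, sum_range_succ']
    simp; ring

lemma WW_one (n : ℕ) : ∀ {f : ℕ → ℕ} {M K l c : ℕ}, St f M K l c →
    WW n f M 1 = cb n K + l * cE n K := by
  induction n with
  | zero => intros; simp [WW, cb_zero, cE_zero]
  | succ n ih =>
    intro f M K l c h
    rw [WW_split h n 1 (by omega), ih h.upd0, ih h.upd1,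
      sum_congr rfl (fun j hj => ih (h.updj j (mem_range.1 hj))), cb_rec, cE_rec,
      sum_range_succ, sum_range_succ']
    simp only [le_refl, if_true, Nat.sub_self]
    rw [sum_congr rfl (fun j hj => WW_zero n (h.upd4 j (mem_range.1 hj)))]
    simp; ring

lemma sum_aux (l : ℕ) (x y : ℤ) :
    ∑ j ∈ range l, (x + ((j + 1 : ℕ) : ℤ) * y) = l * x + ((l + 1).choose 2 : ℕ) * y := by
  induction l with
  | zero => simp
  | succ l ih =>
    rw [sum_range_succ, ih, Nat.choose_succ_succ (l + 1) 1]; push_cast; simp; ring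

lemma sum_aux2 (K : ℕ) (g : ℕ → ℤ) (y : ℕ → ℤ) :
    ∑ j ∈ range K, (g j + ((if j = 0 then K else 0 : ℕ) : ℤ) * y j)
      = ∑ j ∈ range K, g j + K * y 0 := by
  rw [sum_add_distrib]
  congr 1
  rcases K with _ | K
  · simp
  · rw [sum_eq_single 0]
    · simp
    · intro b _ hb; simp [hb]
    · simp

lemma WW_two (n : ℕ) : ∀ {f : ℕ → ℕ} {M K l c : ℕ}, St f M K l c →
    WW n f M 2 = cd n K + l * cF n K + ((l + 1).choose 2 : ℕ) * cH n K + c * cE n K := by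
  induction n with
  | zero => intros; simp [WW, cd_zero, cF_zero, cH_zero, cE_zero]
  | succ n ih =>
    intro f M K l c h
    rw [WW_split h n 2 (by omega), ih h.upd0, ih h.upd1,
      sum_congr rfl (fun j hj => ih (h.updj j (mem_range.1 hj))), cd_rec, cE_rec, cF_rec, cH_rec,
      sum_range_succ, sum_range_succ']
    simp only [le_refl, if_true, Nat.sub_self, show 1 ≤ 2 by omega, show 2 - 1 = 1 from rfl]
    rw [sum_congr rfl (fun j hj => WW_zero n (h.upd5 j (mem_range.1 hj))),
      sum_congr rfl (fun j hj => WW_one n (h.upd4 j (mem_range.1 hj))), sum_aux]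
    have := sum_aux2 K (fun j => cd n (j + 1)) (fun j => cE n (j + 1))
    simp at this ⊢
    rw [this]
    ring
/-! ### Building permutations by inserting a new first entry -/

def ins {n : ℕ} (p : Fin (n + 1)) (σ : Equiv.Perm (Fin n)) : Equiv.Perm (Fin (n + 1)) :=
  (finSuccEquiv n).trans ((Equiv.optionCongr σ).trans (finSuccEquiv' p).symm)

lemma ins_zero {n : ℕ} (p : Fin (n + 1)) (σ : Equiv.Perm (Fin n)) : ins p σ 0 = p := by
  simp [ins]

lemma ins_succ {n : ℕ} (p : Fin (n + 1)) (σ : Equiv.Perm (Fin n)) (a : Fin n) :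
    ins p σ a.succ = p.succAbove (σ a) := by
  simp [ins]

lemma ins_bij (n : ℕ) : Function.Bijective
    (fun x : Fin (n + 1) × Equiv.Perm (Fin n) => ins x.1 x.2) := by
  rw [Fintype.bijective_iff_injective_and_card]
  constructor
  · rintro ⟨p, σ⟩ ⟨q, τ⟩ h
    simp only at h
    have h0 : p = q := by rw [← ins_zero p σ, h, ins_zero]
    subst h0
    have : σ = τ := by
      ext a
      have := congrArg (fun π => π a.succ) h
      simp only [ins_succ] at this
      rw [Fin.succAbove_right_injective this]
    rw [this]
  · simp [Fintype.card_perm, Nat.factorial_succ]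

/-- Inversions whose larger value is below `i`. -/
def fi {n : ℕ} (σ : Equiv.Perm (Fin n)) (i : ℕ) : ℕ :=
  ∑ a : Fin n, ∑ b : Fin n, if a < b ∧ σ b < σ a ∧ (σ a : ℕ) < i then 1 else 0

/-- Occurrences of the pattern 321. -/
def N321 {n : ℕ} (σ : Equiv.Perm (Fin n)) : ℕ :=
  ∑ a : Fin n, ∑ b : Fin n, ∑ c : Fin n,
    if a < b ∧ b < c ∧ σ b < σ a ∧ σ c < σ b then 1 else 0

lemma succAbove_lt_iff {n : ℕ} (p : Fin (n + 1)) (x : Fin n) :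
    p.succAbove x < p ↔ (x : ℕ) < p := by
  rw [Fin.succAbove_lt_iff_castSucc_lt]; rfl

lemma succAbove_val_lt {n : ℕ} (p : Fin (n + 1)) (x : Fin n) (i : ℕ) :
    (p.succAbove x : ℕ) < i ↔ (x : ℕ) < if i ≤ p then i else i - 1 := by
  rcases lt_or_ge (x : ℕ) p with h | h
  · rw [Fin.succAbove_of_castSucc_lt _ _ (by exact h)]
    simp only [Fin.val_castSucc]; split_ifs <;> omega
  · rw [Fin.succAbove_of_le_castSucc _ _ (by exact h)]
    simp only [Fin.val_succ]; split_ifs <;> omega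

lemma count_lt {n : ℕ} (p : Fin (n + 1)) (σ : Equiv.Perm (Fin n)) :
    (∑ b : Fin n, if (σ b : ℕ) < p then 1 else 0) = (p : ℕ) := by
  rw [Equiv.sum_comp σ (fun x : Fin n => if (x : ℕ) < p then 1 else 0),
    Fin.sum_univ_eq_sum_range (fun x => if x < (p : ℕ) then 1 else 0) n, ← card_filter]
  have : filter (fun x => x < (p : ℕ)) (range n) = range p := by
    ext x; simp; have := p.2; omega
  rw [this, card_range]

lemma fi_ins {n : ℕ} (p : Fin (n + 1)) (σ : Equiv.Perm (Fin n)) (i : ℕ) :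
    fi (ins p σ) i = upd (fi σ) p i := by
  simp only [fi, Fin.sum_univ_succ, ins_zero, ins_succ, Fin.succ_lt_succ_iff, lt_irrefl, false_and,
    if_false, Fin.not_lt_zero, zero_add, Fin.succ_pos, true_and, succAbove_lt_iff,
    Fin.succAbove_lt_succAbove_iff, succAbove_val_lt, upd]
  split_ifs with h
  · simp [show ¬ ((p : ℕ) < i) by omega]
  · simp only [show ((p : ℕ) < i) by omega, and_true, count_lt]
    ring

lemma N321_ins {n : ℕ} (p : Fin (n + 1)) (σ : Equiv.Perm (Fin n)) :
    N321 (ins p σ) = N321 σ + fi σ p := by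
  simp only [N321, fi, Fin.sum_univ_succ, ins_zero, ins_succ, Fin.succ_lt_succ_iff, lt_irrefl,
    false_and, and_false,
    if_false, Fin.not_lt_zero, zero_add, Fin.succ_pos, true_and, succAbove_lt_iff,
    Fin.succAbove_lt_succAbove_iff, sum_const_zero]
  rw [add_comm]
  congr 1
  refine sum_congr rfl fun a _ => sum_congr rfl fun b _ => ?_
  congr 1
  simp only [eq_iff_iff]
  tauto

/-- The number of permutations with exactly `r` occurrences of 321. -/
lemma count_eq_WW (r n : ℕ) : ∀ m : ℕ,
    (∑ σ : Equiv.Perm (Fin m), if N321 σ ≤ r then WW n (fi σ) m (r - N321 σ) else 0)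
      = ∑ σ : Equiv.Perm (Fin (m + n)), if N321 σ = r then 1 else 0 := by
  induction n with
  | zero =>
    intro m
    refine sum_congr rfl fun σ _ => ?_
    simp only [WW]
    split_ifs <;> first | rfl | omega
  | succ n ih =>
    intro m
    have h := ih (m + 1)
    rw [show m + (n + 1) = m + 1 + n by ring, ← h,
      ← Function.Bijective.sum_comp (ins_bij m)
        (fun π => if N321 π ≤ r then WW n (fi π) (m + 1) (r - N321 π) else 0),
      Fintype.sum_prod_type, sum_comm]
    refine sum_congr rfl fun σ _ => ?_
    have e : ∀ p : Fin (m + 1), fi (ins p σ) = upd (fi σ) p := fun p => funext (fi_ins p σ)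
    simp only [e, N321_ins]
    rw [Fin.sum_univ_eq_sum_range (fun p => if N321 σ + fi σ p ≤ r then
      WW n (upd (fi σ) p) (m + 1) (r - (N321 σ + fi σ p)) else 0) (m + 1), WW]
    split_ifs with h1
    · refine sum_congr rfl fun p _ => ?_
      rw [Nat.sub_sub]
      congr 1
      simp only [eq_iff_iff]; omega
    · symm
      apply sum_eq_zero
      intro p _
      rw [if_neg (by omega)]

lemma N3_eq {n : ℕ} (π : Equiv.Perm (Fin n)) : N3 π = N321 (π.trans Fin.revPerm) := by
  simp only [N3, N321, card_filter, Fintype.sum_prod_type, Equiv.trans_apply, Fin.revPerm_apply,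
    Fin.rev_lt_rev]

lemma count_N3 (n r : ℕ) :
    ((Finset.univ.filter fun π : Equiv.Perm (Fin n) => N3 π = r).card : ℤ)
      = WW n (fun _ => 0) 0 r := by
  have h := count_eq_WW r n 0
  rw [show 0 + n = n by ring] at h
  have e : ∀ σ : Equiv.Perm (Fin 0), fi σ = fun _ => 0 := by
    intro σ; funext i; simp [fi]
  have e' : ∀ σ : Equiv.Perm (Fin 0), N321 σ = 0 := by
    intro σ; simp [N321]
  simp only [e, e'] at h
  simp at h
  rw [h]
  simp only [N3_eq]
  norm_cast
  exact card_bijective (fun π : Equiv.Perm (Fin n) => π.trans Fin.revPerm)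
    ((Equiv.mulLeft (Fin.revPerm : Equiv.Perm (Fin n))).bijective) (by simp)

/-! ### Final arithmetic -/

lemma count_two (n : ℕ) :
    ((Finset.univ.filter fun π : Equiv.Perm (Fin (n + 1)) => N3 π = 2).card : ℤ) = cd n 0 := by
  rw [count_N3, WW]
  have h : St (upd (fun _ => 0) 0) 1 0 0 0 :=
    ⟨by omega, by intros; simp [upd], by intros; omega, by intros; omega, by intros; omega⟩
  simp [WW_two n h]

lemma PB_ratio (a : ℕ) (b : ℤ) : PB a (b - 1) * (a - b + 1) = PB a b * b := by
  rcases lt_trichotomy b 0 with h | h | h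
  · rw [PB_neg _ _ h, PB_neg _ _ (by omega)]; ring
  · subst h; rw [PB_neg _ _ (by omega)]; ring
  · obtain ⟨c, rfl⟩ : ∃ c : ℕ, b = (c : ℤ) + 1 := ⟨(b - 1).toNat, by omega⟩
    have e : ((c : ℤ) + 1) = ((c + 1 : ℕ) : ℤ) := by push_cast; rfl
    rw [show (c : ℤ) + 1 - 1 = (c : ℤ) by ring, e, PB_nat, PB_nat]
    have h := Nat.choose_succ_right_eq a c
    rcases le_or_gt c a with h' | h'
    · rw [show (a : ℤ) - ((c + 1 : ℕ) : ℤ) + 1 = ((a - c : ℕ) : ℤ) by omega]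
      exact_mod_cast h.symm
    · rw [Nat.choose_eq_zero_of_lt h', Nat.choose_eq_zero_of_lt (by omega)]; simp

lemma cd_final (m : ℕ) : cd (m + 3) 0 = 3 * PB (2 * m + 5) m + 3 * PB (2 * m + 5) (m - 1)
    - 2 * PB (2 * m + 5) (m - 2) - 3 * PB (2 * m + 5) (m - 3) - PB (2 * m + 5) (m - 4) := by
  simp only [cd, cH, cE, cF]
  rw [show 2 * (m + 3) + 0 - 1 = (2 * m + 5) by omega,
    show 2 * (m + 3 + 1) + 0 - 1 = (2 * m + 5) + 2 by omega,
    show 2 * (m + 3) + 1 = (2 * m + 5) + 2 by omega]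
  simp only [PB_two (2 * m + 5)]
  push_cast
  ring_nf

lemma two_aux (m : ℕ) :
    (Finset.univ.filter fun π : Equiv.Perm (Fin (m + 4)) => N3 π = 2).card *
        (m.factorial * (m + 9).factorial) =
      (2 * m + 6).factorial * (59 * (m + 4) ^ 2 + 117 * (m + 4) + 100) := by
  have h0 : PB (2 * m + 5) m * (m.factorial * (m + 5).factorial) = (2 * m + 5).factorial := by
    rw [PB_nat]
    have := Nat.choose_mul_factorial_mul_factorial (n := 2 * m + 5) (k := m) (by omega)
    rw [show 2 * m + 5 - m = m + 5 by omega] at this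
    rw [← mul_assoc]
    exact_mod_cast this
  have h1 := PB_ratio (2 * m + 5) m
  have h2 := PB_ratio (2 * m + 5) (m - 1)
  have h3 := PB_ratio (2 * m + 5) (m - 2)
  have h4 := PB_ratio (2 * m + 5) (m - 3)
  rw [show (m : ℤ) - 1 - 1 = m - 2 by ring] at h2
  rw [show (m : ℤ) - 2 - 1 = m - 3 by ring] at h3
  rw [show (m : ℤ) - 3 - 1 = m - 4 by ring] at h4
  have hc := count_two (m + 3)
  rw [cd_final, show m + 3 + 1 = m + 4 from rfl] at hc
  generalize (Finset.univ.filter fun π : Equiv.Perm (Fin (m + 4)) => N3 π = 2).card = X at *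
  zify
  rw [hc, show m + 9 = (m + 5) + 4 by ring, show 2 * m + 6 = (2 * m + 5) + 1 by ring]
  simp only [Nat.factorial_succ (m + 5 + 3), Nat.factorial_succ (m + 5 + 2),
    Nat.factorial_succ (m + 5 + 1), Nat.factorial_succ (m + 5), Nat.factorial_succ (2 * m + 5)]
  push_cast at h0 h1 h2 h3 h4 ⊢
  rw [← h0]
  generalize PB (2 * m + 5) m = P0 at *
  generalize PB (2 * m + 5) (m - 1) = P1 at *
  generalize PB (2 * m + 5) (m - 2) = P2 at *
  generalize PB (2 * m + 5) (m - 3) = P3 at *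
  generalize PB (2 * m + 5) (m - 4) = P4 at *
  generalize ((m + 5).factorial : ℤ) = U at *
  generalize (m.factorial : ℤ) = V at *
  generalize (m : ℤ) = x at *
  have e1 : P1 * (x + 6) = P0 * x := by linear_combination h1
  have e2 : P2 * ((x + 6) * (x + 7)) = P0 * (x * (x - 1)) := by
    linear_combination (x + 6) * h2 + (x - 1) * e1
  have e3 : P3 * ((x + 6) * (x + 7) * (x + 8)) = P0 * (x * (x - 1) * (x - 2)) := by
    linear_combination (x + 6) * (x + 7) * h3 + (x - 2) * e2
  have e4 : P4 * ((x + 6) * (x + 7) * (x + 8) * (x + 9)) = P0 * (x * (x - 1) * (x - 2) * (x - 3)) := by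
    linear_combination (x + 6) * (x + 7) * (x + 8) * h4 + (x - 3) * e3
  linear_combination U * V * (3 * (x + 7) * (x + 8) * (x + 9) * e1 - 2 * (x + 8) * (x + 9) * e2
    - 3 * (x + 9) * e3 - e4)

theorem two_occurrences_123 (n : ℕ) (hn : 4 ≤ n) :
    (Finset.univ.filter fun π : Equiv.Perm (Fin n) => N3 π = 2).card *
        (2 * n * (2 * n - 1) * (n + 5)) =
      (59 * n ^ 2 + 117 * n + 100) * Nat.choose (2 * n) (n - 4) ∧
    (Finset.univ.filter fun π : Equiv.Perm (Fin n) => N3 π = 2).card *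
        ((n - 4).factorial * (n + 5).factorial) =
      (2 * n - 2).factorial * (59 * n ^ 2 + 117 * n + 100) := by
  obtain ⟨m, rfl⟩ : ∃ m, n = m + 4 := ⟨n - 4, by omega⟩
  have h := two_aux m
  have hch := Nat.choose_mul_factorial_mul_factorial (n := 2 * (m + 4)) (k := m) (by omega)
  rw [show 2 * (m + 4) - m = m + 8 by omega,
    show 2 * (m + 4) = (2 * m + 6) + 1 + 1 by ring, Nat.factorial_succ (2 * m + 6 + 1),
    Nat.factorial_succ (2 * m + 6)] at hch
  rw [show m + 4 - 4 = m by omega, show 2 * (m + 4) - 2 = 2 * m + 6 by omega,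
    show m + 4 + 5 = m + 9 by ring, show 2 * (m + 4) - 1 = 2 * m + 7 by omega,
    show 2 * (m + 4) = (2 * m + 6) + 1 + 1 by ring]
  refine ⟨?_, h⟩
  have hpos : 0 < m.factorial * (m + 8).factorial := by positivity
  apply Nat.eq_of_mul_eq_mul_right hpos
  rw [show m + 9 = (m + 8) + 1 by ring, Nat.factorial_succ (m + 8)] at h
  generalize (Finset.univ.filter fun π : Equiv.Perm (Fin (m + 4)) => N3 π = 2).card = X at *
  zify at h hch ⊢
  push_cast at h hch ⊢
  linear_combination (2 * (m : ℤ) + 6 + 1 + 1) * (2 * m + 7) * h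
    - (59 * ((m : ℤ) + 4) ^ 2 + 117 * (m + 4) + 100) * hch
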